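/- arXiv:1911.10523 — 2 statements merged into one kernel-verified Lean document; each statement's English description precedes it below -/
import Mathlib

section
/- Let a, L > 0. There exist constants c > 0 and ℓ₀ > 0, depending only on a and L, with the following property. For every ℓ ∈ (0, ℓ₀], let Q^ℓ = [0, ℓ]², let ρ : Q^ℓ → ℝ be Lipschitz continuous with Lipschitz constant at most L and satisfying ρ(x) ≥ a for all x ∈ Q^ℓ, let ν be the probability measure on Q^ℓ with density r(x) = ρ(x) / ∫_{Q^ℓ} ρ, and let σ^ℓ be the uniform probability measure on Q^ℓ (density ℓ^{-2}). Then for every positive integer R, if X^R denotes the empirical measure of R points sampled independently from ν and Z^R denotes the empirical measure of R points sampled independently from σ^ℓ, one has E_ν[W₂²(X^R, ν)] ≤ (1 + cℓ) · E_{σ^ℓ}[W₂²(Z^R, σ^ℓ)]. -/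
open MeasureTheory Filter
open scoped ENNReal NNReal Topology

noncomputable section

/-- The plane, with the Euclidean norm. -/
abbrev E2 : Type := EuclideanSpace ℝ (Fin 2)

/-- The square `Q^ℓ = [0,ℓ]²`. -/
def sqSet (ℓ : ℝ) : Set E2 := {x | ∀ i, x i ∈ Set.Icc (0 : ℝ) ℓ}

/-- The squared 2-Wasserstein distance `W₂²(ν₁, ν₂)`: the infimum of
`∫ |x − y|² dJ` over all couplings `J` of `ν₁` and `ν₂`. -/
def W2sq (ν₁ ν₂ : Measure E2) : ℝ :=
  sInf {c | ∃ J : Measure (E2 × E2), IsProbabilityMeasure J ∧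
    J.map Prod.fst = ν₁ ∧ J.map Prod.snd = ν₂ ∧
    c = ∫ p, ‖p.1 - p.2‖ ^ 2 ∂J}

/-- The empirical measure `X^R = (1/R) Σ_{i=1}^R δ_{x_i}`. -/
def empMeas {R : ℕ} (x : Fin R → E2) : Measure E2 :=
  (R : ℝ≥0∞)⁻¹ • ∑ i, Measure.dirac (x i)


lemma W2sq_le {ν₁ ν₂ : Measure E2} (J : Measure (E2 × E2)) [IsProbabilityMeasure J]
    (h1 : J.map Prod.fst = ν₁) (h2 : J.map Prod.snd = ν₂) :
    W2sq ν₁ ν₂ ≤ ∫ p, ‖p.1 - p.2‖ ^ 2 ∂J := by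
  refine csInf_le ⟨0, ?_⟩ ⟨J, inferInstance, h1, h2, rfl⟩
  rintro c ⟨J, _, _, _, rfl⟩
  positivity

lemma W2sq_nonneg (ν₁ ν₂ : Measure E2) : 0 ≤ W2sq ν₁ ν₂ := by
  apply Real.sInf_nonneg
  rintro c ⟨J, _, _, _, rfl⟩
  positivity

lemma W2sq_set_nonempty (ν₁ ν₂ : Measure E2) [IsProbabilityMeasure ν₁] [IsProbabilityMeasure ν₂] :
    {c | ∃ J : Measure (E2 × E2), IsProbabilityMeasure J ∧
    J.map Prod.fst = ν₁ ∧ J.map Prod.snd = ν₂ ∧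
    c = ∫ p, ‖p.1 - p.2‖ ^ 2 ∂J}.Nonempty :=
  ⟨_, ν₁.prod ν₂, inferInstance, by simp [Measure.map_fst_prod],
    by simp [Measure.map_snd_prod], rfl⟩

lemma empMeas_prob {R : ℕ} (hR : 0 < R) (x : Fin R → E2) : IsProbabilityMeasure (empMeas x) := by
  constructor
  simp [empMeas]
  exact ENNReal.inv_mul_cancel (by simp; omega) (by simp)

/-- Coupling built from a family of conditional laws. -/
def Jof {R : ℕ} (z : Fin R → E2) (κ : Fin R → Measure E2) : Measure (E2 × E2) :=
  (R : ℝ≥0∞)⁻¹ • ∑ i, (κ i).map (Prod.mk (z i))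

lemma Jof_prob {R : ℕ} (hR : 0 < R) (z : Fin R → E2) (κ : Fin R → Measure E2)
    [∀ i, IsProbabilityMeasure (κ i)] : IsProbabilityMeasure (Jof z κ) := by
  constructor
  have : ∀ i, (κ i).map (Prod.mk (z i)) Set.univ = 1 := fun i => by
    rw [Measure.map_apply (by fun_prop) MeasurableSet.univ]; simp
  simp [Jof, this]
  exact ENNReal.inv_mul_cancel (by simp; omega) (by simp)

lemma Jof_fst {R : ℕ} (z : Fin R → E2) (κ : Fin R → Measure E2)
    [∀ i, IsProbabilityMeasure (κ i)] : (Jof z κ).map Prod.fst = empMeas z := by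
  ext s hs
  simp only [Jof, empMeas]
  rw [Measure.map_apply measurable_fst hs]
  simp only [Measure.smul_apply, Measure.finsetSum_apply]
  congr 1
  refine Finset.sum_congr rfl fun i _ => ?_
  rw [Measure.map_apply (by fun_prop) (measurable_fst hs), Measure.dirac_apply' _ hs]
  by_cases h : z i ∈ s <;> simp [Set.preimage, h]

lemma Jof_snd {R : ℕ} (z : Fin R → E2) (κ : Fin R → Measure E2) :
    (Jof z κ).map Prod.snd = (R : ℝ≥0∞)⁻¹ • ∑ i, κ i := by
  ext s hs
  simp only [Jof]
  rw [Measure.map_apply measurable_snd hs]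
  simp only [Measure.smul_apply, Measure.finsetSum_apply]
  congr 1
  refine Finset.sum_congr rfl fun i _ => ?_
  rw [Measure.map_apply (by fun_prop) (measurable_snd hs)]
  rfl

lemma exists_Jof {R : ℕ} (z : Fin R → E2) (J : Measure (E2 × E2)) [IsProbabilityMeasure J]
    (h1 : J.map Prod.fst = empMeas z) :
    J = Jof z (fun i => J.condKernel (z i)) := by
  have h := J.disintegrate J.condKernel
  have hf : J.fst = empMeas z := h1
  ext s hs
  conv_lhs => rw [← h]
  rw [Measure.compProd_apply hs, hf, empMeas, lintegral_smul_measure,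
    lintegral_finsetSum_measure]
  simp only [Jof, Measure.smul_apply, Measure.finsetSum_apply, smul_eq_mul]
  congr 1
  refine Finset.sum_congr rfl fun i _ => ?_
  rw [lintegral_dirac, Measure.map_apply (by fun_prop) hs]

lemma cost_Jof_continuous {R : ℕ} (hR : 0 < R) (κ : Fin R → Measure E2)
    [∀ i, IsProbabilityMeasure (κ i)] {K : Set E2} (hK : IsCompact K)
    (hκ : ∀ i, κ i Kᶜ = 0) :
    Continuous fun z : Fin R → E2 => ∫ p, ‖p.1 - p.2‖ ^ 2 ∂(Jof z κ) := by
  have hr : ∀ i, (κ i).restrict K = κ i := fun i =>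
    Measure.restrict_eq_self_of_ae_mem (by rw [ae_iff]; exact hκ i)
  have hint : ∀ (i) (w : E2), Integrable (fun y => ‖w - y‖ ^ 2) (κ i) := fun i w => by
    rw [← hr i]
    exact ContinuousOn.integrableOn_compact hK (by fun_prop)
  have e : ∀ z : Fin R → E2, ∫ p, ‖p.1 - p.2‖ ^ 2 ∂(Jof z κ)
      = ((R : ℝ≥0∞)⁻¹).toReal • ∑ i, ∫ y in K, ‖z i - y‖ ^ 2 ∂(κ i) := fun z => by
    rw [Jof, integral_smul_measure, integral_finsetSum_measure]
    · congr 1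
      refine Finset.sum_congr rfl fun i _ => ?_
      rw [hr, integral_map (by fun_prop)]
      exact Continuous.aestronglyMeasurable (by fun_prop)
    · intro i _
      rw [integrable_map_measure (Continuous.aestronglyMeasurable (by fun_prop)) (by fun_prop)]
      exact hint i (z i)
  simp_rw [e]
  have hs : Continuous fun z : Fin R → E2 => ∑ i, ∫ y in K, ‖z i - y‖ ^ 2 ∂(κ i) := by
    refine continuous_finsetSum _ fun i _ => ?_
    have := continuous_parametric_integral_of_continuous (μ := κ i) (s := K)
      (f := fun (w : E2) (y : E2) => ‖w - y‖ ^ 2) (by fun_prop) hK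
    exact this.comp (continuous_apply i)
  exact hs.const_smul (((R : ℝ≥0∞)⁻¹).toReal)

lemma measurable_W2sq {R : ℕ} (hR : 0 < R) (μ : Measure E2) [IsProbabilityMeasure μ]
    {K : Set E2} (hK : IsCompact K) (hμ : μ Kᶜ = 0) :
    Measurable fun z : Fin R → E2 => W2sq (empMeas z) μ := by
  refine measurable_of_Iio fun c => IsOpen.measurableSet ?_
  rw [isOpen_iff_mem_nhds]
  intro z hz
  have := empMeas_prob hR z
  obtain ⟨_, ⟨J, hJ, h1, h2, rfl⟩, hlt⟩ := exists_lt_of_csInf_lt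
    (W2sq_set_nonempty (empMeas z) μ) hz
  have hJe := exists_Jof z J h1
  set κ : Fin R → Measure E2 := fun i => J.condKernel (z i) with hκd
  have : ∀ i, IsProbabilityMeasure (κ i) := fun i => by rw [hκd]; infer_instance
  have hs : (R : ℝ≥0∞)⁻¹ • ∑ i, κ i = μ := by rw [← Jof_snd z κ, ← hJe, h2]
  have hκ : ∀ i, κ i Kᶜ = 0 := by
    rw [← hs] at hμ
    simp at hμ
    exact hμ
  have hc := (cost_Jof_continuous hR κ hK hκ)
  rw [hJe] at hlt
  filter_upwards [hc.continuousAt.eventually_lt continuousAt_const hlt] with z' hz'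
  have := Jof_prob hR z' κ
  exact (W2sq_le _ (Jof_fst z' κ) ((Jof_snd z' κ).trans hs)).trans_lt hz'

lemma W2sq_map_le {R : ℕ} (hR : 0 < R) (σ : Measure E2) [IsProbabilityMeasure σ]
    {K : Set E2} (hK : IsCompact K) (hσ : σ Kᶜ = 0) (T : E2 → E2) (hT : Measurable T)
    (C : ℝ) (hTL : ∀ x ∈ K, ∀ y ∈ K, ‖T x - T y‖ ^ 2 ≤ C * ‖x - y‖ ^ 2) (hC : 0 < C)
    (z : Fin R → E2) (hz : ∀ i, z i ∈ K) :
    W2sq (empMeas fun i => T (z i)) (σ.map T) ≤ C * W2sq (empMeas z) σ := by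
  have := empMeas_prob hR z
  rw [← div_le_iff₀' hC]
  refine le_csInf (W2sq_set_nonempty _ _) ?_
  rintro _ ⟨J, hJ, h1, h2, rfl⟩
  rw [div_le_iff₀' hC]
  have hTT : Measurable (Prod.map T T) := hT.prodMap hT
  have hp : IsProbabilityMeasure (J.map (Prod.map T T)) :=
    Measure.isProbabilityMeasure_map hTT.aemeasurable
  have a1 : ∀ᵐ p ∂J, p.1 ∈ K := by
    have : ∀ᵐ x ∂(J.map Prod.fst), x ∈ K := by
      rw [h1, ae_iff]
      simp only [empMeas, Measure.smul_apply, Measure.finsetSum_apply]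
      have : ∀ i, Measure.dirac (z i) {a | a ∉ K} = 0 := fun i => by
        change Measure.dirac (z i) Kᶜ = 0
        rw [Measure.dirac_apply' _ hK.measurableSet.compl]; simp [hz i]
      simp [this]
    exact ae_of_ae_map measurable_fst.aemeasurable this
  have a2 : ∀ᵐ p ∂J, p.2 ∈ K := by
    have : ∀ᵐ x ∂(J.map Prod.snd), x ∈ K := by
      rw [h2, ae_iff]; exact hσ
    exact ae_of_ae_map measurable_snd.aemeasurable this
  have hle := W2sq_le (J.map (Prod.map T T)) (ν₁ := empMeas fun i => T (z i)) (ν₂ := σ.map T) ?_ ?_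
  · refine hle.trans ?_
    rw [integral_map hTT.aemeasurable (Continuous.aestronglyMeasurable (by fun_prop)),
      ← integral_const_mul]
    have hr : J.restrict (K ×ˢ K) = J := Measure.restrict_eq_self_of_ae_mem (by
      filter_upwards [a1, a2] with p h h' using ⟨h, h'⟩)
    refine integral_mono_of_nonneg (ae_of_all _ fun p => by positivity) ?_ ?_
    · rw [← hr]
      exact ContinuousOn.integrableOn_compact (hK.prod hK) (by fun_prop)
    · filter_upwards [a1, a2] with p h h' using hTL _ h _ h'
  · rw [Measure.map_map measurable_fst hTT]
    have : Prod.fst ∘ Prod.map T T = T ∘ Prod.fst := rfl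
    rw [this, ← Measure.map_map hT measurable_fst, h1]
    ext s hs
    rw [Measure.map_apply hT hs]
    simp [empMeas, Measure.dirac_apply' _ hs, Measure.dirac_apply' _ (hT hs)]
    rfl
  · rw [Measure.map_map measurable_snd hTT]
    have : Prod.snd ∘ Prod.map T T = T ∘ Prod.snd := rfl
    rw [this, ← Measure.map_map hT measurable_snd, h2]

lemma W2sq_bound {R : ℕ} (hR : 0 < R) (σ : Measure E2) [IsProbabilityMeasure σ]
    {K : Set E2} (hK : IsCompact K) (hσ : σ Kᶜ = 0) :
    ∃ B : ℝ, ∀ z : Fin R → E2, (∀ i, z i ∈ K) → W2sq (empMeas z) σ ≤ B := by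
  obtain ⟨B, hB⟩ := (hK.prod hK).exists_bound_of_continuousOn
    (f := fun p : E2 × E2 => ‖p.1 - p.2‖ ^ 2) (by fun_prop)
  refine ⟨B, fun z hz => ?_⟩
  have := Jof_prob hR z (fun _ => σ)
  have hr : (R : ℝ≥0∞)⁻¹ • ∑ i : Fin R, σ = σ := by
    ext s hs
    simp
    rw [← mul_assoc, ENNReal.inv_mul_cancel (by simp; omega) (by simp), one_mul]
  refine (W2sq_le _ (Jof_fst z fun _ => σ) ((Jof_snd z fun _ => σ).trans hr)).trans ?_
  have hae : ∀ᵐ p ∂(Jof z fun _ => σ), p ∈ K ×ˢ K := by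
    rw [ae_iff]
    have hm : MeasurableSet {a : E2 × E2 | a ∉ K ×ˢ K} := (hK.prod hK).measurableSet.compl
    simp only [Jof, Measure.smul_apply, Measure.finsetSum_apply, smul_eq_mul]
    have : ∀ i, (σ.map (Prod.mk (z i))) {a : E2 × E2 | a ∉ K ×ˢ K} = 0 := fun i => by
      rw [Measure.map_apply (by fun_prop) hm]
      refine measure_mono_null (fun y hy => ?_) hσ
      simpa [hz i] using hy
    rw [Finset.sum_eq_zero fun i _ => this i, mul_zero]
  have h := norm_integral_le_of_norm_le_const (μ := Jof z fun _ => σ)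
    (f := fun p : E2 × E2 => ‖p.1 - p.2‖ ^ 2) (C := B)
    (by filter_upwards [hae] with p hp using hB p hp)
  simp only [probReal_univ, mul_one] at h
  exact (le_abs_self _).trans h

lemma compare_of_map {R : ℕ} (hR : 0 < R) (ν σ : Measure E2) [IsProbabilityMeasure ν]
    {Q : Set E2} (hQ : IsCompact Q) (hν : ν Qᶜ = 0) (S : E2 → E2) (hS : Continuous S)
    (hmap : ν.map S = σ) (ε : ℝ) (hε0 : 0 ≤ ε) (hε : ε ≤ 1 / 4)
    (hSL : ∀ x ∈ Q, ∀ y ∈ Q, (1 - ε) * ‖x - y‖ ≤ ‖S x - S y‖) :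
    ∫ x : Fin R → E2, W2sq (empMeas x) ν ∂(Measure.pi fun _ => ν) ≤
      (1 + 8 * ε) * ∫ z : Fin R → E2, W2sq (empMeas z) σ ∂(Measure.pi fun _ => σ) := by
  have hσp : IsProbabilityMeasure σ := by
    rw [← hmap]; exact Measure.isProbabilityMeasure_map hS.measurable.aemeasurable
  have hK : IsCompact (S '' Q) := hQ.image hS
  set K := S '' Q with hKd
  have hσ : σ Kᶜ = 0 := by
    rw [← hmap, Measure.map_apply hS.measurable hK.measurableSet.compl]
    exact measure_mono_null (fun x hx hxQ => hx ⟨x, hxQ, rfl⟩) hν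
  have hinj : Set.InjOn S Q := fun x hx y hy hxy => by
    have := hSL x hx y hy
    rw [hxy, sub_self, norm_zero] at this
    have h2 : ‖x - y‖ ≤ 0 := by nlinarith [norm_nonneg (x - y)]
    exact sub_eq_zero.1 (norm_le_zero_iff.1 h2)
  set T0 := Function.invFunOn S Q with hT0
  have hT0S : ∀ x ∈ Q, T0 (S x) = x := fun x hx => hinj.leftInvOn_invFunOn hx
  have hT0L : ∀ x ∈ K, ∀ y ∈ K, (1 - ε) * ‖T0 x - T0 y‖ ≤ ‖x - y‖ := by
    rintro _ ⟨x, hx, rfl⟩ _ ⟨y, hy, rfl⟩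
    rw [hT0S x hx, hT0S y hy]
    exact hSL x hx y hy
  have hT0c : ContinuousOn T0 K := by
    have : LipschitzOnWith 2 T0 K := LipschitzOnWith.of_dist_le_mul fun x hx y hy => by
      rw [dist_eq_norm, dist_eq_norm]
      have := hT0L x hx y hy
      have : ((2 : ℝ≥0) : ℝ) = 2 := rfl
      rw [this]
      nlinarith [norm_nonneg (T0 x - T0 y)]
    exact this.continuousOn
  classical
  set T : E2 → E2 := K.piecewise T0 (fun _ => 0) with hT
  have hTm : Measurable T := hT0c.measurable_piecewise continuousOn_const hK.measurableSet
  have hTe : ∀ x ∈ K, T x = T0 x := fun x hx => Set.piecewise_eq_of_mem _ _ _ hx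
  have hTmap : σ.map T = ν := by
    rw [← hmap, Measure.map_map hTm hS.measurable]
    conv_rhs => rw [← Measure.map_id (μ := ν)]
    refine Measure.map_congr ?_
    have : ∀ᵐ x ∂ν, x ∈ Q := by rw [ae_iff]; exact hν
    filter_upwards [this] with x hx
    simp [hTe (S x) ⟨x, hx, rfl⟩, hT0S x hx]
  have hTL : ∀ x ∈ K, ∀ y ∈ K, ‖T x - T y‖ ^ 2 ≤ (1 + 8 * ε) * ‖x - y‖ ^ 2 := by
    intro x hx y hy
    rw [hTe x hx, hTe y hy]
    have h := hT0L x hx y hy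
    have h2 : ((1 - ε) * ‖T0 x - T0 y‖) ^ 2 ≤ ‖x - y‖ ^ 2 := by
      have : 0 ≤ 1 - ε := by linarith
      gcongr
    have h3 : 1 ≤ (1 + 8 * ε) * (1 - ε) ^ 2 := by nlinarith [mul_nonneg hε0 hε0, mul_nonneg hε0 (mul_nonneg hε0 hε0)]
    calc ‖T0 x - T0 y‖ ^ 2 ≤ ((1 + 8 * ε) * (1 - ε) ^ 2) * ‖T0 x - T0 y‖ ^ 2 :=
          le_mul_of_one_le_left (by positivity) h3
      _ = (1 + 8 * ε) * ((1 - ε) * ‖T0 x - T0 y‖) ^ 2 := by ring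
      _ ≤ _ := by gcongr
  have hpi : (Measure.pi fun _ : Fin R => ν) =
      (Measure.pi fun _ : Fin R => σ).map (fun z i => T (z i)) := by
    have := (measurePreserving_pi (fun _ : Fin R => σ) (fun _ : Fin R => ν) (f := fun _ => T)
      (fun _ => ⟨hTm, hTmap⟩)).map_eq
    exact this.symm
  have hzK : ∀ᵐ z ∂(Measure.pi fun _ : Fin R => σ), ∀ i, z i ∈ K := by
    rw [ae_all_iff]
    intro i
    have : ∀ᵐ x ∂σ, x ∈ K := by rw [ae_iff]; exact hσ
    exact (Measure.tendsto_eval_ae_ae (μ := fun _ : Fin R => σ) (i := i)).eventually this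
  have hTT : Measurable fun (z : Fin R → E2) (i : Fin R) => T (z i) :=
    measurable_pi_lambda _ fun i => hTm.comp (measurable_pi_apply i)
  rw [hpi, integral_map hTT.aemeasurable
    (measurable_W2sq hR ν hQ hν).aestronglyMeasurable, ← integral_const_mul]
  obtain ⟨B, hB⟩ := W2sq_bound hR σ hK hσ
  refine integral_mono_of_nonneg (ae_of_all _ fun z => W2sq_nonneg _ _) (Integrable.const_mul ?_ _) ?_
  · refine Integrable.of_bound (measurable_W2sq hR σ hK hσ).aestronglyMeasurable B ?_
    filter_upwards [hzK] with z hz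
    rw [Real.norm_of_nonneg (W2sq_nonneg _ _)]
    exact hB z hz
  · filter_upwards [hzK] with z hz
    have := W2sq_map_le hR σ hK hσ T hTm (1 + 8 * ε) hTL (by positivity) z hz
    rwa [hTmap] at this

lemma oneD {ℓ : ℝ} (hℓ : 0 < ℓ) (h : ℝ → ℝ) (hc : Continuous h) (h0 : ∀ x, 0 ≤ h x)
    (hi : ∫ t in (0 : ℝ)..ℓ, h t = ℓ) (u : ℝ → ℝ≥0∞) :
    ∫⁻ x in Set.Icc 0 ℓ, ENNReal.ofReal (h x) * u (∫ t in (0 : ℝ)..x, h t)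
      = ∫⁻ x in Set.Icc 0 ℓ, u x := by
  set F : ℝ → ℝ := fun x => ∫ t in (0 : ℝ)..x, h t with hF
  have hd : ∀ x, HasDerivAt F (h x) x := fun x =>
    intervalIntegral.integral_hasDerivAt_right (hc.intervalIntegrable _ _)
      (hc.stronglyMeasurableAtFilter _ _) hc.continuousAt
  have hmono : Monotone F := monotone_of_deriv_nonneg (fun x => (hd x).differentiableAt)
    (fun x => by rw [(hd x).deriv]; exact h0 x)
  have hFc : Continuous F := continuous_iff_continuousAt.2 fun x => (hd x).continuousAt
  have hF0 : F 0 = 0 := by simp [hF]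
  have hFl : F ℓ = ℓ := hi
  have him : F '' Set.Icc 0 ℓ = Set.Icc 0 ℓ := by
    apply Set.Subset.antisymm
    · rintro _ ⟨x, hx, rfl⟩
      constructor
      · rw [← hF0]; exact hmono hx.1
      · calc F x ≤ F ℓ := hmono hx.2
          _ = ℓ := hFl
    · have := intermediate_value_Icc hℓ.le hFc.continuousOn
      rwa [hF0, hFl] at this
  have := lintegral_image_eq_lintegral_deriv_mul_of_monotoneOn (s := Set.Icc 0 ℓ) measurableSet_Icc
    (fun x _ => (hd x).hasDerivWithinAt) (hmono.monotoneOn _) u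
  rw [him] at this
  exact this.symm

def AA (ℓ : ℝ) (r : ℝ → ℝ → ℝ) (x : ℝ) : ℝ := ∫ t in (0 : ℝ)..ℓ, r x t
def MM (ℓ : ℝ) (r : ℝ → ℝ → ℝ) : ℝ := ∫ s in (0 : ℝ)..ℓ, AA ℓ r s
def SS1 (ℓ : ℝ) (r : ℝ → ℝ → ℝ) (x : ℝ) : ℝ := ∫ s in (0 : ℝ)..x, ℓ * AA ℓ r s / MM ℓ r
def SS2 (ℓ : ℝ) (r : ℝ → ℝ → ℝ) (x y : ℝ) : ℝ := ∫ t in (0 : ℝ)..y, ℓ * r x t / AA ℓ r x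

structure Good (a L ℓ : ℝ) (r : ℝ → ℝ → ℝ) : Prop where
  ha : 0 < a
  hL : 0 < L
  hℓ : 0 < ℓ
  hc : Continuous (Function.uncurry r)
  lb : ∀ x t, a ≤ r x t
  o1 : ∀ x x' t, |r x t - r x' t| ≤ L * ℓ
  o2 : ∀ x t t', |r x t - r x t'| ≤ L * ℓ
  l1 : ∀ x x' t, |r x t - r x' t| ≤ L * |x - x'|

namespace Good
variable {a L ℓ : ℝ} {r : ℝ → ℝ → ℝ}

lemma cx (h : Good a L ℓ r) (x : ℝ) : Continuous (r x) :=
  h.hc.comp (by fun_prop : Continuous fun t => (x, t))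

lemma cA (h : Good a L ℓ r) : Continuous (AA ℓ r) :=
  intervalIntegral.continuous_parametric_intervalIntegral_of_continuous' h.hc _ _

lemma A_lb (h : Good a L ℓ r) (x : ℝ) : a * ℓ ≤ AA ℓ r x := by
  have := intervalIntegral.integral_mono_on (a := 0) (b := ℓ) (f := fun _ => a) (g := r x) (μ := volume)
    h.hℓ.le (by simp) ((h.cx x).intervalIntegrable _ _) (fun t _ => h.lb x t)
  simp at this
  rw [AA]; linarith

lemma A_pos (h : Good a L ℓ r) (x : ℝ) : 0 < AA ℓ r x :=
  lt_of_lt_of_le (mul_pos h.ha h.hℓ) (h.A_lb x)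

lemma M_lb (h : Good a L ℓ r) : a * ℓ ^ 2 ≤ MM ℓ r := by
  have := intervalIntegral.integral_mono_on (a := 0) (b := ℓ) (f := fun _ => a * ℓ) (g := AA ℓ r)
    (μ := volume) h.hℓ.le (by simp) (h.cA.intervalIntegrable _ _) (fun t _ => h.A_lb t)
  simp at this
  rw [MM]; linarith

lemma M_pos (h : Good a L ℓ r) : 0 < MM ℓ r :=
  lt_of_lt_of_le (mul_pos h.ha (pow_pos h.hℓ 2)) h.M_lb

lemma P_diff (h : Good a L ℓ r) (x x' y C : ℝ) (hC : ∀ t, |r x t - r x' t| ≤ C) :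
    |(∫ t in (0 : ℝ)..y, r x t) - ∫ t in (0 : ℝ)..y, r x' t| ≤ C * |y| := by
  rw [← intervalIntegral.integral_sub ((h.cx x).intervalIntegrable _ _)
    ((h.cx x').intervalIntegrable _ _)]
  have := intervalIntegral.norm_integral_le_of_norm_le_const (a := 0) (b := y) (C := C)
    (f := fun t => r x t - r x' t) (fun t _ => hC t)
  simpa using this

lemma A_diff (h : Good a L ℓ r) (x x' : ℝ) : |AA ℓ r x - AA ℓ r x'| ≤ L * ℓ * ℓ := by
  have := h.P_diff x x' ℓ _ (h.o1 x x')
  rwa [abs_of_pos h.hℓ] at this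

lemma A_lip (h : Good a L ℓ r) (x x' : ℝ) : |AA ℓ r x - AA ℓ r x'| ≤ L * |x - x'| * ℓ := by
  have := h.P_diff x x' ℓ _ (h.l1 x x')
  rwa [abs_of_pos h.hℓ] at this

/-- comparison of a positive function with its mean -/
lemma mean_diff (h : Good a L ℓ r) (f : ℝ → ℝ) (hf : Continuous f) (s C : ℝ)
    (hC : ∀ t, |f s - f t| ≤ C) : |ℓ * f s - ∫ t in (0 : ℝ)..ℓ, f t| ≤ C * ℓ := by
  have e : ℓ * f s - ∫ t in (0 : ℝ)..ℓ, f t = ∫ t in (0 : ℝ)..ℓ, (f s - f t) := by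
    rw [intervalIntegral.integral_sub (by simp) (hf.intervalIntegrable _ _)]
    simp
  rw [e]
  have := intervalIntegral.norm_integral_le_of_norm_le_const (a := 0) (b := ℓ) (C := C)
    (f := fun t => f s - f t) (fun t _ => hC t)
  simpa [abs_of_pos h.hℓ] using this

lemma d1 (h : Good a L ℓ r) (s : ℝ) : |ℓ * AA ℓ r s / MM ℓ r - 1| ≤ L * ℓ / a := by
  have hM := h.M_pos
  have h1 := h.mean_diff (AA ℓ r) h.cA s _ (h.A_diff s)
  change |ℓ * AA ℓ r s - MM ℓ r| ≤ _ at h1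
  rw [div_sub_one hM.ne', abs_div, abs_of_pos hM, div_le_div_iff₀ hM h.ha]
  calc _ ≤ (L * ℓ * ℓ * ℓ) * a := by have := h.ha.le; gcongr
    _ = L * ℓ * (a * ℓ ^ 2) := by ring
    _ ≤ _ := by have := h.M_lb; have := h.hL; have := h.hℓ; gcongr

lemma d2 (h : Good a L ℓ r) (x t : ℝ) : |ℓ * r x t / AA ℓ r x - 1| ≤ L * ℓ / a := by
  have hM := h.A_pos x
  have h1 := h.mean_diff (r x) (h.cx x) t _ (h.o2 x t)
  change |ℓ * r x t - AA ℓ r x| ≤ _ at h1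
  rw [div_sub_one hM.ne', abs_div, abs_of_pos hM, div_le_div_iff₀ hM h.ha]
  calc _ ≤ (L * ℓ * ℓ) * a := by have := h.ha.le; gcongr
    _ = L * ℓ * (a * ℓ) := by ring
    _ ≤ _ := by have := h.A_lb x; have := h.hL; have := h.hℓ; gcongr

lemma prim_diff (f : ℝ → ℝ) (hf : Continuous f) (C : ℝ) (hC : ∀ t, |f t - 1| ≤ C) (x x' : ℝ) :
    |((∫ t in (0 : ℝ)..x, f t) - ∫ t in (0 : ℝ)..x', f t) - (x - x')| ≤ C * |x - x'| := by
  have e : ((∫ t in (0 : ℝ)..x, f t) - ∫ t in (0 : ℝ)..x', f t) - (x - x')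
      = ∫ t in x'..x, (f t - 1) := by
    rw [intervalIntegral.integral_interval_sub_left (hf.intervalIntegrable _ _)
      (hf.intervalIntegrable _ _), intervalIntegral.integral_sub (hf.intervalIntegrable _ _) (by simp)]
    simp
  rw [e]
  have := intervalIntegral.norm_integral_le_of_norm_le_const (a := x') (b := x) (C := C)
    (f := fun t => f t - 1) (fun t _ => hC t)
  simpa using this

lemma cf1 (h : Good a L ℓ r) : Continuous fun s => ℓ * AA ℓ r s / MM ℓ r := by
  have := h.cA
  fun_prop

lemma cf2 (h : Good a L ℓ r) : Continuous (Function.uncurry fun x t => ℓ * r x t / AA ℓ r x) := by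
  have h1 := h.cA.comp (continuous_fst (X := ℝ) (Y := ℝ))
  have h2 := h.hc
  exact (h2.const_mul ℓ).div h1 fun p => (h.A_pos _).ne'

lemma cf2x (h : Good a L ℓ r) (x : ℝ) : Continuous (fun t => ℓ * r x t / AA ℓ r x) :=
  h.cf2.comp (by fun_prop : Continuous fun t => (x, t))

lemma S1_est (h : Good a L ℓ r) (x x' : ℝ) :
    |(SS1 ℓ r x - SS1 ℓ r x') - (x - x')| ≤ L * ℓ / a * |x - x'| :=
  prim_diff _ h.cf1 _ h.d1 x x'

lemma S2_est2 (h : Good a L ℓ r) (x y y' : ℝ) :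
    |(SS2 ℓ r x y - SS2 ℓ r x y') - (y - y')| ≤ L * ℓ / a * |y - y'| :=
  prim_diff _ (h.cf2x x) _ (h.d2 x) y y'

lemma SS2_eq (x y : ℝ) : SS2 ℓ r x y = ℓ * (∫ t in (0 : ℝ)..y, r x t) / AA ℓ r x := by
  simp only [SS2]
  rw [intervalIntegral.integral_div, intervalIntegral.integral_const_mul]

lemma S2_est1 (h : Good a L ℓ r) (x x' y : ℝ) (hy : y ∈ Set.Icc 0 ℓ) :
    |SS2 ℓ r x y - SS2 ℓ r x' y| ≤ 2 * (L * ℓ / a) * |x - x'| := by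
  rw [SS2_eq, SS2_eq]
  have hP := h.P_diff x x' y _ (h.l1 x x')
  have hA := h.A_lip x x'
  have hlb := h.A_lb x
  have hx := h.A_pos x
  have hx' := h.A_pos x'
  have hL := h.hL
  have hℓ := h.hℓ
  have ha := h.ha
  have hPn : 0 ≤ ∫ t in (0 : ℝ)..y, r x' t :=
    intervalIntegral.integral_nonneg hy.1 fun t _ => ha.le.trans (h.lb _ _)
  have hPA : ∫ t in (0 : ℝ)..y, r x' t ≤ AA ℓ r x' := by
    refine intervalIntegral.integral_mono_interval le_rfl hy.1 hy.2
      (ae_of_all _ fun t => ha.le.trans (h.lb _ _)) ((h.cx x').intervalIntegrable _ _)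
  rw [abs_of_nonneg hy.1] at hP
  set P := ∫ t in (0 : ℝ)..y, r x t
  set P' := ∫ t in (0 : ℝ)..y, r x' t
  set A := AA ℓ r x
  set A' := AA ℓ r x'
  have e : ℓ * P / A - ℓ * P' / A' = ℓ * ((P - P') * A' - P' * (A - A')) / (A * A') := by
    field_simp; ring
  rw [e, abs_div, abs_of_pos (mul_pos hx hx'), div_le_iff₀ (mul_pos hx hx'), abs_mul, abs_of_pos hℓ]
  have k1 : |(P - P') * A' - P' * (A - A')| ≤ 2 * (L * |x - x'| * ℓ) * A' := by
    calc _ ≤ |(P - P') * A'| + |P' * (A - A')| := abs_sub _ _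
      _ = |P - P'| * A' + P' * |A - A'| := by rw [abs_mul, abs_mul, abs_of_pos hx', abs_of_nonneg hPn]
      _ ≤ (L * |x - x'| * ℓ) * A' + A' * (L * |x - x'| * ℓ) := by
          gcongr
          exact hP.trans (by have := hy.2; gcongr)
      _ = _ := by ring
  calc ℓ * |(P - P') * A' - P' * (A - A')| ≤ ℓ * (2 * (L * |x - x'| * ℓ) * A') := by gcongr
    _ = 2 * (L * ℓ / a) * |x - x'| * ((a * ℓ) * A') := by field_simp
    _ ≤ _ := by gcongr

lemma cS1 (h : Good a L ℓ r) : Continuous (SS1 ℓ r) :=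
  intervalIntegral.continuous_primitive (fun _ _ => h.cf1.intervalIntegrable _ _) 0

lemma cS2 (h : Good a L ℓ r) : Continuous (Function.uncurry (SS2 ℓ r)) := by
  have := intervalIntegral.continuous_parametric_intervalIntegral_of_continuous (μ := volume)
    (a₀ := 0) (f := fun (p : ℝ × ℝ) t => ℓ * r p.1 t / AA ℓ r p.1) (s := Prod.snd)
    (h.cf2.comp (by fun_prop : Continuous fun q : (ℝ × ℝ) × ℝ => (q.1.1, q.2))) continuous_snd
  exact this

lemma push (h : Good a L ℓ r) (g : ℝ → ℝ → ℝ≥0∞) :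
    ∫⁻ x in Set.Icc 0 ℓ, ∫⁻ y in Set.Icc 0 ℓ,
      ENNReal.ofReal (r x y / MM ℓ r) * g (SS1 ℓ r x) (SS2 ℓ r x y)
    = ENNReal.ofReal (ℓ ^ 2)⁻¹ * ∫⁻ x in Set.Icc 0 ℓ, ∫⁻ y in Set.Icc 0 ℓ, g x y := by
  have hℓ := h.hℓ
  have hM := h.M_pos
  have inner : ∀ x, ∫⁻ y in Set.Icc 0 ℓ,
      ENNReal.ofReal (r x y / MM ℓ r) * g (SS1 ℓ r x) (SS2 ℓ r x y) =
      ENNReal.ofReal (ℓ ^ 2)⁻¹ * (ENNReal.ofReal (ℓ * AA ℓ r x / MM ℓ r) *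
        ∫⁻ y in Set.Icc 0 ℓ, g (SS1 ℓ r x) y) := fun x => by
    have hA := h.A_pos x
    have k := oneD hℓ _ (h.cf2x x) (fun t => by
      have := (h.ha.le.trans (h.lb x t)); positivity) ?_ (g (SS1 ℓ r x))
    · rw [← k, ← mul_assoc, ← ENNReal.ofReal_mul (by positivity), ← lintegral_const_mul' _ _ (by simp)]
      refine lintegral_congr fun y => ?_
      rw [← mul_assoc, ← ENNReal.ofReal_mul (by positivity)]
      congr 2
      field_simp
    · rw [intervalIntegral.integral_div, intervalIntegral.integral_const_mul]
      exact mul_div_cancel_right₀ _ hA.ne'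
  simp_rw [inner]
  rw [lintegral_const_mul' _ _ (by simp)]
  congr 1
  refine oneD hℓ _ h.cf1 (fun t => ?_) ?_ (fun w => ∫⁻ y in Set.Icc 0 ℓ, g w y)
  · have := h.A_pos t; positivity
  · rw [intervalIntegral.integral_div, intervalIntegral.integral_const_mul]
    exact mul_div_cancel_right₀ _ hM.ne'

end Good

/-- The identification of the product plane with `E2`. -/
def pr (p : ℝ × ℝ) : E2 := !₂[p.1, p.2]

lemma pr_cont : Continuous pr := by
  unfold pr
  refine (PiLp.continuous_toLp 2 _).comp (continuous_pi fun i => ?_)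
  fin_cases i <;> simp <;> fun_prop

lemma pr_mp : MeasurePreserving pr (volume : Measure (ℝ × ℝ)) (volume : Measure E2) := by
  have h1 := (volume_preserving_finTwoArrow ℝ).symm
  have h2 := PiLp.volume_preserving_toLp (Fin 2)
  have := h2.comp h1
  have e : pr = WithLp.toLp 2 ∘ (MeasurableEquiv.finTwoArrow (α := ℝ)).symm := by
    funext p
    ext i
    fin_cases i <;> simp [pr]
  rw [e]
  exact this

lemma pr_restrict (ℓ : ℝ) :
    (volume.restrict (sqSet ℓ) : Measure E2) =
      (((volume : Measure ℝ).restrict (Set.Icc 0 ℓ)).prod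
        ((volume : Measure ℝ).restrict (Set.Icc 0 ℓ))).map pr := by
  have hm : MeasurableSet (sqSet ℓ) := by
    have : sqSet ℓ = ⋂ i, (fun x : E2 => x i) ⁻¹' Set.Icc 0 ℓ := by ext; simp [sqSet]
    rw [this]
    exact MeasurableSet.iInter fun i => measurableSet_Icc.preimage (by fun_prop)
  rw [Measure.prod_restrict]
  have := (pr_mp.restrict_preimage hm).map_eq
  rw [← this]
  congr 2
  ext p
  simp [sqSet, pr, Fin.forall_fin_two, -Set.Icc_prod_Icc]

lemma sqSet_compact (ℓ : ℝ) : IsCompact (sqSet ℓ) := by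
  have : sqSet ℓ = pr '' (Set.Icc 0 ℓ ×ˢ Set.Icc 0 ℓ) := by
    ext x
    constructor
    · intro hx
      refine ⟨(x 0, x 1), ⟨hx 0, hx 1⟩, ?_⟩
      ext i
      fin_cases i <;> simp [pr]
    · rintro ⟨p, hp, rfl⟩
      simpa [sqSet, pr, Fin.forall_fin_two, -Set.Icc_prod_Icc] using hp
  rw [this]
  exact (isCompact_Icc.prod isCompact_Icc).image pr_cont

lemma pr_norm_le (x y : E2) (i : Fin 2) : |x i - y i| ≤ ‖x - y‖ := by
  have := PiLp.norm_apply_le (x - y) i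
  simpa using this

lemma norm_le_add (v : E2) : ‖v‖ ≤ |v 0| + |v 1| := by
  rw [EuclideanSpace.norm_eq]
  apply Real.sqrt_le_iff.2 ⟨by positivity, ?_⟩
  simp only [Fin.sum_univ_two, Real.norm_eq_abs]
  nlinarith [abs_nonneg (v 0), abs_nonneg (v 1)]

/-- Clamping to `[0,ℓ]`. -/
def cl (ℓ x : ℝ) : ℝ := max 0 (min x ℓ)

lemma cl_cont (ℓ : ℝ) : Continuous (cl ℓ) := by unfold cl; fun_prop

lemma cl_mem {ℓ : ℝ} (hℓ : 0 < ℓ) (x : ℝ) : cl ℓ x ∈ Set.Icc 0 ℓ :=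
  ⟨le_max_left _ _, max_le hℓ.le (min_le_right _ _)⟩

lemma cl_eq {ℓ x : ℝ} (hx : x ∈ Set.Icc 0 ℓ) : cl ℓ x = x := by
  rw [cl, min_eq_left hx.2, max_eq_right hx.1]

lemma cl_lip (ℓ x y : ℝ) : |cl ℓ x - cl ℓ y| ≤ |x - y| := by
  unfold cl
  have h1 := abs_max_sub_max_le_abs (min x ℓ) (min y ℓ) 0
  rw [max_comm 0, max_comm 0]
  refine h1.trans ?_
  exact (abs_min_sub_min_le_max x ℓ y ℓ).trans (by simp)

lemma cl_osc {ℓ : ℝ} (hℓ : 0 < ℓ) (x y : ℝ) : |cl ℓ x - cl ℓ y| ≤ ℓ := by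
  have h1 := cl_mem hℓ x
  have h2 := cl_mem hℓ y
  rw [abs_le]; constructor <;> linarith [h1.1, h1.2, h2.1, h2.2]

lemma pr_cl_mem {ℓ : ℝ} (hℓ : 0 < ℓ) (x y : ℝ) : pr (cl ℓ x, cl ℓ y) ∈ sqSet ℓ := by
  have h1 := cl_mem hℓ x
  have h2 := cl_mem hℓ y
  simpa [sqSet, pr, Fin.forall_fin_two] using And.intro h1 h2

lemma good_of {a L ℓ : ℝ} (ha : 0 < a) (hL : 0 < L) (hℓ : 0 < ℓ) (ρ : E2 → ℝ)
    (hρ : LipschitzOnWith (Real.toNNReal L) ρ (sqSet ℓ)) (hlb : ∀ x ∈ sqSet ℓ, a ≤ ρ x) :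
    Good a L ℓ (fun x y => ρ (pr (cl ℓ x, cl ℓ y))) := by
  have key : ∀ x y x' y', |ρ (pr (cl ℓ x, cl ℓ y)) - ρ (pr (cl ℓ x', cl ℓ y'))| ≤
      L * (|cl ℓ x - cl ℓ x'| + |cl ℓ y - cl ℓ y'|) := by
    intro x y x' y'
    have := hρ.dist_le_mul _ (pr_cl_mem hℓ x y) _ (pr_cl_mem hℓ x' y')
    rw [Real.dist_eq, Real.coe_toNNReal _ hL.le, dist_eq_norm] at this
    refine this.trans ?_
    gcongr
    refine (norm_le_add _).trans ?_
    simp [pr]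
  refine ⟨ha, hL, hℓ, ?_, fun x t => hlb _ (pr_cl_mem hℓ x t), ?_, ?_, ?_⟩
  · have hc : Continuous fun p : ℝ × ℝ => pr (cl ℓ p.1, cl ℓ p.2) :=
      pr_cont.comp (((cl_cont ℓ).comp continuous_fst).prodMk ((cl_cont ℓ).comp continuous_snd))
    exact hρ.continuousOn.comp_continuous hc fun p => pr_cl_mem hℓ p.1 p.2
  · intro x x' t
    refine (key x t x' t).trans ?_
    have := cl_osc hℓ x x'
    gcongr; simpa using this
  · intro x t t'
    refine (key x t x t').trans ?_
    have := cl_osc hℓ t t'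
    gcongr; simpa using this
  · intro x x' t
    refine (key x t x' t).trans ?_
    have := cl_lip ℓ x x'
    gcongr; simpa using this

lemma lintegral_sq (ℓ : ℝ) (f : E2 → ℝ≥0∞) (hf : Measurable f) :
    ∫⁻ x in sqSet ℓ, f x = ∫⁻ x in Set.Icc 0 ℓ, ∫⁻ y in Set.Icc 0 ℓ, f (pr (x, y)) := by
  rw [pr_restrict, lintegral_map hf pr_cont.measurable, lintegral_prod]
  exact (hf.comp pr_cont.measurable).aemeasurable


/-- For any `a, L > 0` there are `c, ℓ₀ > 0` such that for every small square
`Q^ℓ = [0,ℓ]²` (`0 < ℓ ≤ ℓ₀`) and every `L`-Lipschitz density `ρ ≥ a` on it,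
normalized to the probability measure `ν` of density `r = ρ/∫ρ`, one has
`E_ν[W₂²(X^R, ν)] ≤ (1 + cℓ) E_{σ^ℓ}[W₂²(Z^R, σ^ℓ)]` for all `R ≥ 1`,
where `σ^ℓ` is the uniform probability measure on `Q^ℓ`. -/
theorem small_square_comparison (a L : ℝ) (ha : 0 < a) (hL : 0 < L) :
    ∃ c > (0 : ℝ), ∃ ℓ₀ > (0 : ℝ), ∀ ℓ : ℝ, 0 < ℓ → ℓ ≤ ℓ₀ →
      ∀ ρ : E2 → ℝ, LipschitzOnWith (Real.toNNReal L) ρ (sqSet ℓ) →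
        (∀ x ∈ sqSet ℓ, a ≤ ρ x) →
        ∀ ν σℓ : Measure E2,
          ν = (volume.restrict (sqSet ℓ)).withDensity
              (fun x => ENNReal.ofReal (ρ x / ∫ y in sqSet ℓ, ρ y)) →
          σℓ = (volume.restrict (sqSet ℓ)).withDensity
              (fun _ => ENNReal.ofReal (ℓ ^ 2)⁻¹) →
          ∀ R : ℕ, 0 < R →
            ∫ x : Fin R → E2, W2sq (empMeas x) ν ∂(Measure.pi fun _ => ν) ≤
              (1 + c * ℓ) *
                ∫ z : Fin R → E2, W2sq (empMeas z) σℓ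
                  ∂(Measure.pi fun _ => σℓ) := by
  refine ⟨32 * L / a, by positivity, a / (16 * L), by positivity, ?_⟩
  intro ℓ hℓ hℓ₀ ρ hρ hlb ν σ hν hσ R hR
  have G := good_of ha hL hℓ ρ hρ hlb
  set r : ℝ → ℝ → ℝ := fun x y => ρ (pr (cl ℓ x, cl ℓ y)) with hr
  have hQ := sqSet_compact ℓ
  have hρr : ∀ x ∈ sqSet ℓ, ρ x = r (x 0) (x 1) := by
    intro x hx
    have e : pr (x 0, x 1) = x := by
      ext i
      fin_cases i <;> simp [pr]
    simp only [hr]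
    rw [cl_eq (hx 0), cl_eq (hx 1), e]
  have hrc : Continuous fun x : E2 => r (x 0) (x 1) :=
    G.hc.comp (by fun_prop : Continuous fun x : E2 => (x 0, x 1))
  have hM : ∫ y in sqSet ℓ, ρ y = MM ℓ r := by
    rw [setIntegral_congr_fun hQ.measurableSet hρr, pr_restrict,
      integral_map pr_cont.measurable.aemeasurable hrc.aestronglyMeasurable, integral_prod]
    · simp only [MM, AA, pr]
      rw [intervalIntegral.integral_of_le hℓ.le, integral_Icc_eq_integral_Ioc]
      refine integral_congr_ae (ae_of_all _ fun x => ?_)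
      simp only
      rw [intervalIntegral.integral_of_le hℓ.le, integral_Icc_eq_integral_Ioc]
      rfl
    · rw [Measure.prod_restrict]
      exact ContinuousOn.integrableOn_compact (isCompact_Icc.prod isCompact_Icc)
        (hrc.comp pr_cont).continuousOn
  have hν' : ν = (volume.restrict (sqSet ℓ)).withDensity
      (fun x => ENNReal.ofReal (r (x 0) (x 1) / MM ℓ r)) := by
    rw [hν, hM]
    refine withDensity_congr_ae ?_
    filter_upwards [ae_restrict_mem hQ.measurableSet] with x hx
    rw [hρr x hx]
  have hdm : Measurable fun x : E2 => ENNReal.ofReal (r (x 0) (x 1) / MM ℓ r) :=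
    (hrc.div_const _).measurable.ennreal_ofReal
  set S : E2 → E2 := fun x => pr (SS1 ℓ r (x 0), SS2 ℓ r (x 0) (x 1)) with hS
  have hSc : Continuous S := by
    refine pr_cont.comp (Continuous.prodMk ?_ ?_)
    · exact G.cS1.comp (by fun_prop)
    · exact G.cS2.comp (by fun_prop : Continuous fun x : E2 => (x 0, x 1))
  have hmap : ν.map S = σ := by
    refine Measure.ext_of_lintegral _ fun f hf => ?_
    have hfS : Measurable fun x => f (S x) := hf.comp hSc.measurable
    rw [lintegral_map hf hSc.measurable, hν',
      lintegral_withDensity_eq_lintegral_mul _ hdm hfS,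
      lintegral_sq _ _ (hdm.mul hfS), hσ,
      lintegral_withDensity_eq_lintegral_mul _ measurable_const hf]
    have h1 := G.push fun x y => f (pr (x, y))
    have h2 : ∫⁻ x in sqSet ℓ, ((fun _ => ENNReal.ofReal (ℓ ^ 2)⁻¹ : E2 → ℝ≥0∞) * f : E2 → ℝ≥0∞) x =
        ENNReal.ofReal (ℓ ^ 2)⁻¹ * ∫⁻ x in sqSet ℓ, f x := by
      rw [← lintegral_const_mul _ hf]; rfl
    rw [h2, lintegral_sq _ _ hf, ← h1]
    simp [hS, pr]
  have hσp : σ Set.univ = 1 := by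
    rw [← lintegral_one, hσ, lintegral_withDensity_eq_lintegral_mul _ measurable_const measurable_const,
      lintegral_sq _ _ (measurable_const.mul measurable_const)]
    simp only [Pi.mul_apply, Pi.one_apply, mul_one, lintegral_const, Measure.restrict_apply_univ,
      Real.volume_Icc, sub_zero]
    rw [← ENNReal.ofReal_mul (by positivity), ← ENNReal.ofReal_mul (by positivity)]
    rw [show (ℓ ^ 2)⁻¹ * ℓ * ℓ = 1 by field_simp]
    simp
  have hνp : IsProbabilityMeasure ν := by
    constructor
    rw [← hσp, ← hmap, Measure.map_apply hSc.measurable MeasurableSet.univ, Set.preimage_univ]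
  have hνQ : ν (sqSet ℓ)ᶜ = 0 := by
    rw [hν]
    refine withDensity_absolutelyContinuous _ _ ?_
    rw [Measure.restrict_apply hQ.measurableSet.compl]
    simp
  have hε : 4 * (L * ℓ / a) ≤ 1 / 4 := by
    rw [le_div_iff₀ (by positivity)] at hℓ₀
    rw [← mul_div_assoc, div_le_iff₀ ha]
    linarith
  have := compare_of_map hR ν σ hQ hνQ S hSc hmap (4 * (L * ℓ / a)) (by positivity) hε ?_
  · convert this using 2
    ring
  · intro x hx y hy
    have e1 := G.S1_est (x 0) (y 0)
    have e2 := G.S2_est2 (x 0) (x 1) (y 1)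
    have e3 := G.S2_est1 (x 0) (y 0) (y 1) (hy 1)
    have n0 := pr_norm_le x y 0
    have n1 := pr_norm_le x y 1
    have hn := norm_le_add ((S x - S y) - (x - y))
    simp only [hS, pr, PiLp.sub_apply] at hn
    simp only [PiLp.toLp_apply, Matrix.cons_val_zero, Matrix.cons_val_one] at hn
    have e4 : |SS2 ℓ r (x 0) (x 1) - SS2 ℓ r (y 0) (y 1) - (x 1 - y 1)| ≤
        L * ℓ / a * |x 1 - y 1| + 2 * (L * ℓ / a) * |x 0 - y 0| := by
      refine le_trans ?_ (add_le_add e2 e3)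
      refine le_trans (le_of_eq ?_) (abs_add_le _ _)
      congr 1
      ring
    have hε0 : 0 ≤ L * ℓ / a := by positivity
    have tri : ‖x - y‖ ≤ ‖S x - S y‖ + ‖(S x - S y) - (x - y)‖ := by
      have := norm_sub_le (S x - S y) ((S x - S y) - (x - y))
      simpa using this
    have m0 := mul_le_mul_of_nonneg_left n0 hε0
    have m1 := mul_le_mul_of_nonneg_left n1 hε0
    have hn' : ‖(S x - S y) - (x - y)‖ ≤ 4 * (L * ℓ / a) * ‖x - y‖ := by
      refine hn.trans ?_
      linarith
    linarith
end
end

section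
/- Let z₁ ≠ z₂ be two points in ℝ², L = |z₁ − z₂|, and let μ = ½(δ_{z₁} + δ_{z₂}). For each N, sample x_1,…,x_N and y_1,…,y_N independently with distribution μ, and let C_N = min_π Σ_{i=1}^N |x_i − y_{π(i)}|² be the optimal matching cost. Then lim_{N→∞} E_μ[C_N] / √N = L² / √π. Equivalently, if R and S are independent Binomial(N, 1/2) random variables, then lim_{N→∞} E[|R − S|]/√N = 1/√π. -/
open MeasureTheory Filter
open scoped ENNReal NNReal Topology

noncomputable section

/-- The optimal matching cost `C_N = min_π Σ_i |x_i − y_{π(i)}|²`. -/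
def matchCost {N : ℕ} (x y : Fin N → E2) : ℝ :=
  ⨅ π : Equiv.Perm (Fin N), ∑ i, ‖x i - y (π i)‖ ^ 2

lemma aux_sum_abs_lt (N m : ℕ) (hm : m ≤ N) :
    ∑ k ∈ Finset.range m, ((2 * N).choose k : ℝ) * |(k : ℝ) - N| =
      m * ((2 * N).choose m : ℝ) / 2 := by
  induction m with
  | zero => simp
  | succ m ih =>
    rw [Finset.sum_range_succ, ih (by omega)]
    have h := Nat.choose_succ_right_eq (2 * N) m
    have h2 : ((2 * N).choose (m + 1) : ℝ) * (m + 1) = (2 * N).choose m * (2 * N - m) := by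
      have := congrArg (Nat.cast : ℕ → ℝ) h
      push_cast [Nat.cast_sub (show m ≤ 2 * N by omega)] at this
      exact this
    have h3 : |(m : ℝ) - N| = N - m := by
      rw [abs_of_nonpos]
      · ring
      · have : (m : ℝ) ≤ N := by exact_mod_cast (by omega : m ≤ N)
        linarith
    rw [h3]; push_cast; linarith

lemma aux_sum_abs_ge (N m : ℕ) (hm : N ≤ m) (hm2 : m ≤ 2 * N + 1) :
    ∑ k ∈ Finset.range m, ((2 * N).choose k : ℝ) * |(k : ℝ) - N| =
      N * ((2 * N).choose N : ℝ) - m * ((2 * N).choose m : ℝ) / 2 := by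
  induction m, hm using Nat.le_induction with
  | base => rw [aux_sum_abs_lt N N le_rfl]; ring
  | succ m hm ih =>
    rw [Finset.sum_range_succ, ih (by omega)]
    have h := Nat.choose_succ_right_eq (2 * N) m
    have h2 : ((2 * N).choose (m + 1) : ℝ) * (m + 1) = (2 * N).choose m * (2 * N - m) := by
      have := congrArg (Nat.cast : ℕ → ℝ) h
      push_cast [Nat.cast_sub (show m ≤ 2 * N by omega)] at this
      exact this
    have h3 : |(m : ℝ) - N| = m - N := by
      rw [abs_of_nonneg]
      have : (N : ℝ) ≤ m := by exact_mod_cast hm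
      linarith
    rw [h3]; push_cast; linarith

lemma aux_vandermonde (N : ℕ) (f : ℕ → ℝ) :
    ∑ r ∈ Finset.range (N + 1), ∑ s ∈ Finset.range (N + 1),
      (N.choose r : ℝ) * (N.choose s : ℝ) * f (r + s) =
    ∑ k ∈ Finset.range (2 * N + 1), ((2 * N).choose k : ℝ) * f k := by
  rw [← Finset.sum_product']
  rw [← Finset.sum_fiberwise_of_maps_to (t := Finset.range (2 * N + 1))
    (g := fun p : ℕ × ℕ => p.1 + p.2)]
  · refine Finset.sum_congr rfl fun k _ => ?_
    rw [two_mul, Nat.add_choose_eq]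
    push_cast
    rw [Finset.sum_mul]
    refine Finset.sum_subset_zero_on_sdiff ?_ ?_ ?_
    · intro p hp
      simp only [Finset.mem_filter] at hp
      simpa using hp.2
    · rintro ⟨r, s⟩ hp
      simp only [Finset.mem_sdiff, Finset.mem_filter,
        Finset.mem_product, Finset.mem_range] at hp
      rcases lt_or_ge N r with h | h
      · simp [Nat.choose_eq_zero_of_lt h]
      · have h' : N < s := by
          by_contra hs
          exact hp.2 ⟨⟨by omega, by omega⟩, by simpa using hp.1⟩
        simp [Nat.choose_eq_zero_of_lt h']
    · rintro ⟨r, s⟩ hp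
      simp only [Finset.mem_filter] at hp
      simp [hp.2]
  · rintro ⟨r, s⟩ hp
    simp only [Finset.mem_product, Finset.mem_range] at hp ⊢
    omega

lemma aux_double_sum (N : ℕ) :
    ∑ r ∈ Finset.range (N + 1), ∑ s ∈ Finset.range (N + 1),
      (N.choose r : ℝ) * (N.choose s : ℝ) * |(r : ℝ) - s| =
    N * ((2 * N).choose N : ℝ) := by
  have h := aux_vandermonde N (fun k => |(k : ℝ) - N|)
  rw [aux_sum_abs_ge N (2 * N + 1) (by omega) le_rfl] at h
  simp only [Nat.choose_succ_self, Nat.cast_zero, mul_zero, zero_div, sub_zero] at h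
  rw [← h]
  refine Finset.sum_congr rfl fun r _ => ?_
  rw [← Finset.sum_range_reflect]
  refine Finset.sum_congr rfl fun s hs => ?_
  have hs' : s ≤ N := by simpa [Nat.lt_succ_iff] using hs
  have e : N + 1 - 1 - s = N - s := by omega
  rw [e, Nat.choose_symm hs', Nat.cast_sub hs']
  push_cast
  congr 2
  ring

lemma aux_limit :
    Tendsto (fun N : ℕ => (N * ((2 * N).choose N : ℝ) / 2 ^ (2 * N)) / Real.sqrt N)
      atTop (nhds (1 / Real.sqrt Real.pi)) := by
  have h1 : Tendsto (fun N : ℕ => (N : ℝ) / (2 * N + 1)) atTop (nhds (1 / 2)) := by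
    have h0 : Tendsto (fun N : ℕ => (1 : ℝ) / (2 + 1 / (N : ℝ))) atTop (nhds (1 / (2 + 0))) :=
      tendsto_const_nhds.div (tendsto_const_nhds.add tendsto_one_div_atTop_nhds_zero_nat)
        (by norm_num)
    rw [add_zero] at h0
    refine h0.congr' ?_
    filter_upwards [eventually_gt_atTop 0] with N hN
    have : (0 : ℝ) < N := by exact_mod_cast hN
    field_simp
  have h2 := (h1.div Real.Wallis.tendsto_W_nhds_pi_div_two
    (by positivity)).sqrt
  have e : Real.sqrt (1 / 2 / (Real.pi / 2)) = 1 / Real.sqrt Real.pi := by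
    rw [← Real.sqrt_one, ← Real.sqrt_div zero_le_one, Real.sqrt_one]
    congr 1
    field_simp
  rw [e] at h2
  refine h2.congr' ?_
  filter_upwards [eventually_gt_atTop 0] with N hN
  have hN' : (0 : ℝ) < N := by exact_mod_cast hN
  have hc : ((2 * N).choose N : ℝ) * ((N.factorial : ℝ) * N.factorial) = (2 * N).factorial := by
    have := Nat.choose_mul_factorial_mul_factorial (show N ≤ 2 * N by omega)
    rw [show 2 * N - N = N by omega] at this
    exact_mod_cast (by rw [← mul_assoc]; exact this)
  have hf : (0 : ℝ) < N.factorial := by exact_mod_cast N.factorial_pos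
  have hcp : (0 : ℝ) < (2 * N).choose N := by
    exact_mod_cast Nat.choose_pos (show N ≤ 2 * N by omega)
  rw [Real.sqrt_eq_iff_mul_self_eq (by
    have := Real.Wallis.W_pos N
    simp only [Pi.div_apply]
    positivity) (by positivity)]
  simp only [Pi.div_apply]
  rw [Real.Wallis.W_eq_factorial_ratio, ← hc]
  have hs := Real.mul_self_sqrt hN'.le
  have hsp := Real.sqrt_pos.2 hN'
  rw [div_mul_div_comm, hs, show 4 * N = 2 * N + 2 * N by ring, pow_add]
  field_simp

lemma aux_exists_perm {N : ℕ} (A B : Finset (Fin N)) (h : A.card ≤ B.card) :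
    ∃ π : Equiv.Perm (Fin N), ∀ i ∈ A, π i ∈ B := by
  classical
  obtain ⟨B', hB', hc⟩ := Finset.exists_subset_card_eq h
  let e : {x // x ∈ A} ≃ {x // x ∈ B'} := Finset.equivOfCardEq hc.symm
  exact ⟨e.extendSubtype, fun i hi => hB' (e.extendSubtype_mem i hi)⟩

/-- number of `true` entries -/
def cnt {N : ℕ} (a : Fin N → Bool) : ℕ := (Finset.univ.filter fun i => a i = true).card

lemma cnt_eq {N : ℕ} (a : Fin N → Bool) : (cnt a : ℝ) = ∑ i, if a i = true then (1 : ℝ) else 0 := by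
  simp [cnt]

lemma aux_cost {N : ℕ} (z₁ z₂ : E2) (a b : Fin N → Bool) :
    matchCost (fun i => if a i = true then z₁ else z₂) (fun i => if b i = true then z₁ else z₂) =
      ‖z₁ - z₂‖ ^ 2 * |(cnt a : ℝ) - cnt b| := by
  have key : ∀ π : Equiv.Perm (Fin N), (cnt a : ℝ) - cnt b =
      ∑ i, ((if a i = true then (1 : ℝ) else 0) - if b (π i) = true then 1 else 0) := by
    intro π
    rw [Finset.sum_sub_distrib, cnt_eq, cnt_eq,
      Equiv.sum_comp π (fun i => if b i = true then (1 : ℝ) else 0)]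
  have term : ∀ π : Equiv.Perm (Fin N),
      ∑ i, ‖(if a i = true then z₁ else z₂) - (if b (π i) = true then z₁ else z₂)‖ ^ 2 =
      ‖z₁ - z₂‖ ^ 2 * ∑ i, |(if a i = true then (1 : ℝ) else 0) - if b (π i) = true then 1 else 0| := by
    intro π
    rw [Finset.mul_sum]
    refine Finset.sum_congr rfl fun i _ => ?_
    split_ifs <;> simp [norm_sub_rev]
  have lower : ∀ π : Equiv.Perm (Fin N), ‖z₁ - z₂‖ ^ 2 * |(cnt a : ℝ) - cnt b| ≤
      ∑ i, ‖(if a i = true then z₁ else z₂) - (if b (π i) = true then z₁ else z₂)‖ ^ 2 := by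
    intro π
    rw [term π, key π]
    exact mul_le_mul_of_nonneg_left (Finset.abs_sum_le_sum_abs _ _) (by positivity)
  have upper : ∃ π : Equiv.Perm (Fin N),
      ∑ i, ‖(if a i = true then z₁ else z₂) - (if b (π i) = true then z₁ else z₂)‖ ^ 2 =
        ‖z₁ - z₂‖ ^ 2 * |(cnt a : ℝ) - cnt b| := by
    rcases le_total (cnt a) (cnt b) with h | h
    · obtain ⟨π, hπ⟩ := aux_exists_perm _ _ h
      refine ⟨π, ?_⟩
      have h' : (cnt a : ℝ) - cnt b ≤ 0 := by
        have : (cnt a : ℝ) ≤ cnt b := by exact_mod_cast h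
        linarith
      rw [term π, abs_of_nonpos h', key π, ← Finset.sum_neg_distrib]
      congr 1
      refine Finset.sum_congr rfl fun i _ => abs_of_nonpos ?_
      have := hπ i
      simp only [Finset.mem_filter, Finset.mem_univ, true_and] at this
      split_ifs <;> simp_all
    · obtain ⟨π, hπ⟩ := aux_exists_perm _ _ h
      refine ⟨π.symm, ?_⟩
      have h' : 0 ≤ (cnt a : ℝ) - cnt b := by
        have : (cnt b : ℝ) ≤ cnt a := by exact_mod_cast h
        linarith
      rw [term π.symm, abs_of_nonneg h', key π.symm]
      congr 1
      refine Finset.sum_congr rfl fun i _ => abs_of_nonneg ?_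
      have := hπ (π.symm i)
      simp only [Finset.mem_filter, Finset.mem_univ, true_and, Equiv.apply_symm_apply] at this
      split_ifs <;> simp_all
  obtain ⟨π, hπ⟩ := upper
  unfold matchCost
  refine le_antisymm ?_ (le_ciInf lower)
  rw [← hπ]
  exact ciInf_le (Set.finite_range _).bddBelow π

lemma aux_sum_cnt (N : ℕ) (f : ℕ → ℝ) :
    ∑ a : Fin N → Bool, f (cnt a) = ∑ r ∈ Finset.range (N + 1), (N.choose r : ℝ) * f r := by
  have h := Finset.sum_powerset_apply_card f (x := (Finset.univ : Finset (Fin N)))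
  simp only [Finset.powerset_univ, Finset.card_univ, Fintype.card_fin, nsmul_eq_mul] at h
  rw [← h]
  let e : (Fin N → Bool) ≃ Finset (Fin N) :=
    { toFun := fun a => Finset.univ.filter fun i => a i = true
      invFun := fun s i => decide (i ∈ s)
      left_inv := fun a => by ext i; simp
      right_inv := fun s => by ext i; simp }
  exact Fintype.sum_equiv e _ _ fun a => rfl

lemma aux_measurable (N : ℕ) :
    Measurable fun p : (Fin N → E2) × (Fin N → E2) => matchCost p.1 p.2 := by
  unfold matchCost
  refine Measurable.iInf fun π => ?_
  fun_prop

lemma aux_integral (N : ℕ) (z₁ z₂ : E2) (μ : Measure E2)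
    (hμ : μ = (2 : ℝ≥0∞)⁻¹ • (Measure.dirac z₁ + Measure.dirac z₂)) :
    ∫ p : (Fin N → E2) × (Fin N → E2), matchCost p.1 p.2
          ∂((Measure.pi fun _ => μ).prod (Measure.pi fun _ => μ)) =
      ‖z₁ - z₂‖ ^ 2 * (N * ((2 * N).choose N : ℝ) / 2 ^ (2 * N)) := by
  let ν : Measure Bool := (2 : ℝ≥0∞)⁻¹ • (Measure.dirac true + Measure.dirac false)
  let z : Bool → E2 := fun b => if b = true then z₁ else z₂
  have hz : Measurable z := measurable_of_countable z
  have hmap : μ = ν.map z := by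
    rw [hμ, Measure.map_smul, Measure.map_add _ _ hz, Measure.map_dirac' hz, Measure.map_dirac' hz]
    simp [z]
  have hfin : IsFiniteMeasure ν := ⟨by simp [ν, ENNReal.mul_lt_top_iff]⟩
  have hsing : ∀ b, ν {b} = 2⁻¹ := by
    intro b
    cases b <;> simp [ν]
  let F : (Fin N → Bool) → (Fin N → E2) := fun x i => z (x i)
  have hF : Measurable F := measurable_of_countable F
  have hpi : (Measure.pi fun _ : Fin N => μ) = (Measure.pi fun _ : Fin N => ν).map F := by
    rw [hmap]
    exact (Measure.pi_map_pi (fun _ => hz.aemeasurable)).symm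
  rw [hpi, Measure.map_prod_map _ _ hF hF,
    integral_map (hF.prodMap hF).aemeasurable (aux_measurable N).aestronglyMeasurable,
    integral_fintype Integrable.of_finite]
  have hw : ∀ p : (Fin N → Bool) × (Fin N → Bool),
      ((Measure.pi fun _ : Fin N => ν).prod (Measure.pi fun _ : Fin N => ν)).real {p} =
        1 / 2 ^ (2 * N) := by
    rintro ⟨a, b⟩
    rw [← Set.singleton_prod_singleton, measureReal_def, Measure.prod_prod,
      Measure.pi_singleton, Measure.pi_singleton]
    simp [hsing, two_mul, pow_add]
  simp only [hw]
  have hc : ∀ p : (Fin N → Bool) × (Fin N → Bool),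
      matchCost (Prod.map F F p).1 (Prod.map F F p).2 =
        ‖z₁ - z₂‖ ^ 2 * |(cnt p.1 : ℝ) - cnt p.2| := fun p => aux_cost z₁ z₂ p.1 p.2
  simp only [hc, smul_eq_mul]
  rw [← Finset.mul_sum, ← Finset.mul_sum, Fintype.sum_prod_type]
  have hs : ∑ a : Fin N → Bool, ∑ b : Fin N → Bool, |(cnt a : ℝ) - cnt b| =
      N * ((2 * N).choose N : ℝ) := by
    rw [← aux_double_sum]
    rw [aux_sum_cnt N (fun r => ∑ b : Fin N → Bool, |(r : ℝ) - cnt b|)]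
    refine Finset.sum_congr rfl fun r _ => ?_
    rw [aux_sum_cnt N (fun s => |(r : ℝ) - s|), Finset.mul_sum]
    exact Finset.sum_congr rfl fun s _ => by ring
  rw [hs]
  ring

/-- For `μ = ½(δ_{z₁} + δ_{z₂})` with `z₁ ≠ z₂` and `L = |z₁ − z₂|`, the
expected optimal matching cost of two `N`-samples satisfies
`E_μ[C_N]/√N → L²/√π`; equivalently, for independent `Binomial(N, 1/2)`
variables `R, S` one has `E[|R − S|]/√N → 1/√π`. -/
theorem two_point_cost_asymptotics
    (z₁ z₂ : E2) (hz : z₁ ≠ z₂) (L : ℝ) (hL : L = ‖z₁ - z₂‖)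
    (μ : Measure E2)
    (hμ : μ = (2 : ℝ≥0∞)⁻¹ • (Measure.dirac z₁ + Measure.dirac z₂)) :
    Tendsto (fun N : ℕ =>
        (∫ p : (Fin N → E2) × (Fin N → E2), matchCost p.1 p.2
          ∂((Measure.pi fun _ => μ).prod (Measure.pi fun _ => μ))) /
          Real.sqrt N)
      atTop (nhds (L ^ 2 / Real.sqrt Real.pi)) ∧
    Tendsto (fun N : ℕ =>
        (∑ r ∈ Finset.range (N + 1), ∑ s ∈ Finset.range (N + 1),
          ((N.choose r : ℝ) * (N.choose s : ℝ) / 2 ^ (2 * N)) *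
            |(r : ℝ) - (s : ℝ)|) / Real.sqrt N)
      atTop (nhds (1 / Real.sqrt Real.pi)) := by
  refine ⟨?_, ?_⟩
  · have h := aux_limit.const_mul (L ^ 2)
    rw [mul_one_div] at h
    refine h.congr fun N => ?_
    rw [aux_integral N z₁ z₂ μ hμ, hL]
    ring
  · refine aux_limit.congr fun N => ?_
    rw [← aux_double_sum, Finset.sum_div]
    congr 1
    refine Finset.sum_congr rfl fun r _ => ?_
    rw [Finset.sum_div]
    exact Finset.sum_congr rfl fun s _ => by ring
end
end
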